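/- arXiv:1911.07212 — 2 statements merged into one kernel-verified Lean document; each statement's English description precedes it below -/
import Mathlib

section
/- The weight distribution of the additive code C_4^10 is: the number of elements of Hamming weight w equals 1 for w=0, 87 for w=4, 258 for w=5, 555 for w=6, 1020 for w=7, 1200 for w=8, 738 for w=9, 237 for w=10, and 0 for all other w. -/
open Matrix
open scoped Classical

noncomputable section

abbrev F4 := GaloisField 2 2
abbrev F2 := ZMod 2

/-- Hamming weight: number of nonzero coordinates. -/
def wt {n : ℕ} {α : Type*} [Zero α] (v : Fin n → α) : ℕ :=
  Nat.card {i : Fin n // v i ≠ 0}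

def r1 (ω : F4) : Fin 10 → F4 := ![1, 0, 0, 0, 0, 0, ω, 0, ω, ω + 1]
def r2 (ω : F4) : Fin 10 → F4 := ![ω, 0, 0, 0, 0, 0, ω + 1, 0, ω + 1, 1]
def r3 (ω : F4) : Fin 10 → F4 := ![0, 1, 0, 0, 0, 0, ω + 1, 1, 1, 1]
def r4 (ω : F4) : Fin 10 → F4 := ![0, ω, 0, 0, 0, 0, 1, ω, ω, ω]
def r5 (ω : F4) : Fin 10 → F4 := ![0, 0, 1, 0, 0, 0, 1, ω, ω + 1, 0]
def r6 (ω : F4) : Fin 10 → F4 := ![0, 0, ω, 0, 0, 0, ω, ω + 1, 1, 0]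
def r7 (ω : F4) : Fin 10 → F4 := ![0, 0, 0, 1, 0, 0, 0, 1, ω, ω + 1]
def r8 (ω : F4) : Fin 10 → F4 := ![0, 0, 0, ω, 0, 0, 0, ω, ω + 1, 1]
def r9 (ω : F4) : Fin 10 → F4 := ![0, 0, 0, 0, 1, 0, ω + 1, ω + 1, 0, 1]
def r10 (ω : F4) : Fin 10 → F4 := ![0, 0, 0, 0, ω, 0, 1, 1, 0, ω]
def r11 (ω : F4) : Fin 10 → F4 := ![0, 0, 0, 0, 0, 1, 1, ω, 1, 1]
def r12 (ω : F4) : Fin 10 → F4 := ![0, 0, 0, 0, 0, ω, ω, ω + 1, ω, ω]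

/-- The additive code C₄¹⁰: the GF(2)-linear span of r1, …, r12 in GF(4)¹⁰. -/
def C410 (ω : F4) : Submodule F2 (Fin 10 → F4) :=
  Submodule.span F2 (Set.range ![r1 ω, r2 ω, r3 ω, r4 ω, r5 ω, r6 ω, r7 ω, r8 ω, r9 ω, r10 ω, r11 ω, r12 ω])

/-- The vector whose `j`-th coordinate is `a + b ω`, where `a` and `b` are the bits of `x` at
positions `19 - 2 j` and `18 - 2 j`. -/
def ofBits (ω : F4) (x : ℕ) (j : Fin 10) : F4 :=
  (if x.testBit (19 - 2 * j) then 1 else 0) + (if x.testBit (18 - 2 * j) then ω else 0)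

/-- The number of nonzero coordinates of the vector encoded by `x`. -/
def bitWeight (x : ℕ) : ℕ :=
  (x.testBit 19 || x.testBit 18).toNat + (x.testBit 17 || x.testBit 16).toNat +
  (x.testBit 15 || x.testBit 14).toNat + (x.testBit 13 || x.testBit 12).toNat +
  (x.testBit 11 || x.testBit 10).toNat + (x.testBit 9 || x.testBit 8).toNat +
  (x.testBit 7 || x.testBit 6).toNat + (x.testBit 5 || x.testBit 4).toNat +
  (x.testBit 3 || x.testBit 2).toNat + (x.testBit 1 || x.testBit 0).toNat

/-- All sums (bitwise xor) of sublists of a list of natural numbers. -/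
def xorSpan : List ℕ → List ℕ
  | [] => [0]
  | r :: rs => xorSpan rs ++ (xorSpan rs).map (r ^^^ ·)

/-- The generators `r1`, …, `r12` in the encoding `ofBits`. -/
def rowBits : List ℕ :=
  [524359, 262350, 131306, 65685, 32924, 16504, 8231, 4126, 2290, 1185, 666, 373]

theorem F4.ite_add_ite_eq_zero_iff {ω : F4} (hω : ω ^ 2 = ω + 1) (a b : Bool) :
    ((if a then 1 else 0) + (if b then ω else 0) : F4) = 0 ↔ (a || b) = false := by
  have h0 : ω ≠ 0 := by rintro rfl; simp at hω
  have h1 : 1 + ω ≠ 0 := by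
    intro h
    rw [add_comm ω, h] at hω
    exact h0 (pow_eq_zero_iff two_ne_zero |>.mp hω)
  cases a <;> cases b <;> simp [h0, h1]

theorem ofBits_zero (ω : F4) : ofBits ω 0 = 0 := by
  ext j
  simp [ofBits]

theorem ofBits_xor (ω : F4) (x y : ℕ) : ofBits ω (x ^^^ y) = ofBits ω x + ofBits ω y := by
  have h (c : F4) (a b : Bool) : (if (a ^^ b) then c else 0) =
      (if a then c else 0) + (if b then c else 0) := by
    cases a <;> cases b <;> simp [CharTwo.add_self_eq_zero]
  ext j
  simp only [ofBits, Pi.add_apply, Nat.testBit_xor, h]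
  ring

theorem wt_ofBits {ω : F4} (hω : ω ^ 2 = ω + 1) (x : ℕ) : wt (ofBits ω x) = bitWeight x := by
  have h (b : Bool) : (if b = false then 0 else 1) = b.toNat := by cases b <;> rfl
  simp only [wt, Nat.card_eq_fintype_card, Fintype.card_subtype, Finset.card_filter, ofBits,
    ne_eq, F4.ite_add_ite_eq_zero_iff hω, ite_not, h]
  simp [Fin.sum_univ_succ, bitWeight, add_assoc]

theorem eq_zero_of_bitWeight_eq_zero {x : ℕ} (hx : x < 2 ^ 20) (h : bitWeight x = 0) : x = 0 := by
  simp only [bitWeight, Nat.add_eq_zero_iff, Bool.toNat_eq_zero, Bool.or_eq_false_iff] at h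
  refine Nat.eq_of_testBit_eq fun i ↦ ?_
  rw [Nat.zero_testBit]
  rcases lt_or_ge i 20 with hi | hi
  · interval_cases i <;> tauto
  · exact Nat.testBit_lt_two_pow (hx.trans_le (Nat.pow_le_pow_right two_pos hi))

theorem ofBits_injOn {ω : F4} (hω : ω ^ 2 = ω + 1) : Set.InjOn (ofBits ω) {x | x < 2 ^ 20} := by
  intro x hx y hy h
  have h0 : ofBits ω (x ^^^ y) = 0 := by
    rw [ofBits_xor, h]
    exact funext fun _ ↦ CharTwo.add_self_eq_zero _
  refine Nat.xor_eq_zero_iff.mp (eq_zero_of_bitWeight_eq_zero (Nat.xor_lt_two_pow hx hy) ?_)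
  rw [← wt_ofBits hω, h0]
  simp [wt]

theorem mem_span_image_ofBits (ω : F4) (L : List ℕ) (v : Fin 10 → F4) :
    v ∈ Submodule.span F2 (ofBits ω '' {x | x ∈ L}) ↔ ∃ x ∈ xorSpan L, ofBits ω x = v := by
  induction L generalizing v with
  | nil => simp [xorSpan, ofBits_zero, eq_comm]
  | cons r L ih =>
    have hset : ofBits ω '' {x | x ∈ r :: L} =
        insert (ofBits ω r) (ofBits ω '' {x | x ∈ L}) := by
      ext
      simp [eq_comm]
    have hF2 (p : F2 → Prop) : (∃ a, p a) ↔ p 0 ∨ p 1 := Fin.exists_fin_two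
    rw [hset, Submodule.mem_span_insert, hF2]
    simp only [ih, xorSpan, List.mem_append, List.mem_map, zero_smul, one_smul, zero_add]
    constructor
    · rintro (⟨z, ⟨x, hx, rfl⟩, rfl⟩ | ⟨z, ⟨x, hx, rfl⟩, rfl⟩)
      · exact ⟨x, .inl hx, rfl⟩
      · exact ⟨r ^^^ x, .inr ⟨x, hx, rfl⟩, ofBits_xor ..⟩
    · rintro ⟨_, hx | ⟨x, hx, rfl⟩, rfl⟩
      · exact .inl ⟨_, ⟨_, hx, rfl⟩, rfl⟩
      · exact .inr ⟨_, ⟨x, hx, rfl⟩, ofBits_xor ..⟩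

theorem C410_eq_span (ω : F4) :
    C410 ω = Submodule.span F2 (ofBits ω '' {x | x ∈ rowBits}) := by
  have hrows : (rowBits.map (ofBits ω)) = [r1 ω, r2 ω, r3 ω, r4 ω, r5 ω, r6 ω, r7 ω, r8 ω, r9 ω,
      r10 ω, r11 ω, r12 ω] := by
    simp only [rowBits, List.map_cons, List.map_nil, List.cons.injEq, and_true]
    refine ⟨?_, ?_, ?_, ?_, ?_, ?_, ?_, ?_, ?_, ?_, ?_, ?_⟩ <;> ext j <;> fin_cases j <;>
      simp [ofBits, Nat.testBit_eq_decide_div_mod_eq, r1, r2, r3, r4, r5, r6, r7, r8, r9, r10, r11,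
        r12, add_comm]
  have hset : ofBits ω '' {x | x ∈ rowBits} = {v | v ∈ rowBits.map (ofBits ω)} := by
    ext
    simp
  rw [C410, hset, hrows]
  congr 1
  ext v
  simp only [Matrix.range_cons, Matrix.range_empty, Set.mem_union, Set.mem_singleton_iff,
    Set.mem_empty_iff_false, Set.mem_ofPred_eq, List.mem_cons, List.not_mem_nil]

theorem lt_two_pow_of_mem_xorSpan {L : List ℕ} {n : ℕ} (hL : ∀ r ∈ L, r < 2 ^ n) :
    ∀ x ∈ xorSpan L, x < 2 ^ n := by
  induction L with
  | nil => simp [xorSpan]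
  | cons r L ih =>
    rw [List.forall_mem_cons] at hL
    simp only [xorSpan, List.mem_append, List.mem_map]
    rintro _ (hx | ⟨x, hx, rfl⟩)
    · exact ih hL.2 _ hx
    · exact Nat.xor_lt_two_pow hL.1 (ih hL.2 x hx)

/-- Xor sums are pairwise distinct when the leading bits of the generators strictly descend. -/
theorem nodup_xorSpan {L : List ℕ} (h0 : ∀ r ∈ L, r ≠ 0)
    (hL : L.Pairwise fun r s ↦ Nat.log 2 s < Nat.log 2 r) : (xorSpan L).Nodup := by
  induction L with
  | nil => simp [xorSpan]
  | cons r L ih =>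
    rw [List.forall_mem_cons] at h0
    rw [List.pairwise_cons] at hL
    have hlt := lt_two_pow_of_mem_xorSpan fun s hs ↦
      Nat.lt_pow_of_log_lt one_lt_two (hL.1 s hs)
    refine (ih h0.2 hL.2).append ((ih h0.2 hL.2).map fun _ _ ↦ Nat.xor_right_inj.mp) ?_
    intro x hx hx'
    obtain ⟨y, hy, rfl⟩ := List.mem_map.mp hx'
    have h := Nat.xor_lt_two_pow (hlt _ hx) (hlt y hy)
    rw [Nat.xor_xor_cancel_right] at h
    exact h.not_ge (Nat.pow_log_le_self 2 h0.1)

theorem nodup_xorSpan_rowBits : (xorSpan rowBits).Nodup :=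
  nodup_xorSpan (by decide) (by decide +kernel)

theorem lt_of_mem_xorSpan_rowBits : ∀ x ∈ xorSpan rowBits, x < 2 ^ 20 :=
  lt_two_pow_of_mem_xorSpan (by decide)

theorem countP_bitWeight_xorSpan_rowBits : ∀ w < 11,
    (xorSpan rowBits).countP (fun x ↦ Nat.beq (bitWeight x) w) =
      [1, 0, 0, 0, 87, 258, 555, 1020, 1200, 738, 237].getD w 0 := by
  decide +kernel

theorem ncard_eq_countP {ω : F4} (hω : ω ^ 2 = ω + 1) (w : ℕ) :
    Set.ncard {v | v ∈ C410 ω ∧ wt v = w} =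
      (xorSpan rowBits).countP (fun x ↦ Nat.beq (bitWeight x) w) := by
  set L := (xorSpan rowBits).filter (fun x ↦ Nat.beq (bitWeight x) w) with hL
  have hmem (x : ℕ) : x ∈ L ↔ x ∈ xorSpan rowBits ∧ bitWeight x = w := by
    rw [hL, List.mem_filter, Nat.beq_eq]
  have hset : {v | v ∈ C410 ω ∧ wt v = w} = ofBits ω '' (L.toFinset : Set ℕ) := by
    ext v
    simp only [C410_eq_span, mem_span_image_ofBits, Set.mem_ofPred_eq, Set.mem_image,
      Finset.mem_coe, List.mem_toFinset, hmem]
    constructor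
    · rintro ⟨⟨x, hx, rfl⟩, hw⟩
      exact ⟨x, ⟨hx, wt_ofBits hω x ▸ hw⟩, rfl⟩
    · rintro ⟨x, ⟨hx, hw⟩, rfl⟩
      exact ⟨⟨x, hx, rfl⟩, (wt_ofBits hω x).trans hw⟩
  have hinj : Set.InjOn (ofBits ω) (L.toFinset : Set ℕ) :=
    (ofBits_injOn hω).mono fun x hx ↦
      lt_of_mem_xorSpan_rowBits x ((hmem x).mp (List.mem_toFinset.mp hx)).1
  have hnodup : L.Nodup := nodup_xorSpan_rowBits.filter _
  rw [hset, hinj.ncard_image, Set.ncard_coe_finset,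
    List.toFinset_card_of_nodup hnodup, hL, List.countP_eq_length_filter]

theorem bitWeight_lt (x : ℕ) : bitWeight x < 11 := by
  have h := Bool.toNat_le
  have := h (x.testBit 19 || x.testBit 18)
  have := h (x.testBit 17 || x.testBit 16)
  have := h (x.testBit 15 || x.testBit 14)
  have := h (x.testBit 13 || x.testBit 12)
  have := h (x.testBit 11 || x.testBit 10)
  have := h (x.testBit 9 || x.testBit 8)
  have := h (x.testBit 7 || x.testBit 6)
  have := h (x.testBit 5 || x.testBit 4)
  have := h (x.testBit 3 || x.testBit 2)
  have := h (x.testBit 1 || x.testBit 0)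
  unfold bitWeight
  lia

theorem stmt6 (ω : F4) (hω : ω ^ 2 = ω + 1) (w : ℕ) :
    Set.ncard {v | v ∈ C410 ω ∧ wt v = w} =
      if w = 0 then 1 else if w = 4 then 87 else if w = 5 then 258 else if w = 6 then 555 else if w = 7 then 1020 else if w = 8 then 1200 else if w = 9 then 738 else if w = 10 then 237 else 0 := by
  rw [ncard_eq_countP hω]
  rcases lt_or_ge w 11 with hw | hw
  · rw [countP_bitWeight_xorSpan_rowBits w hw]
    interval_cases w <;> rfl
  · have h0 : (xorSpan rowBits).countP (fun x ↦ Nat.beq (bitWeight x) w) = 0 := by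
      rw [List.countP_eq_zero]
      intro x _
      have := bitWeight_lt x
      rw [Nat.beq_eq]
      lia
    rw [h0]
    split_ifs <;> lia
end
end

section
/- The binary code C_E^40 is an optimal [40,22,8] linear code: the 22 listed generating vectors are linearly independent over GF(2) (so C_E^40 has dimension 22 as a GF(2)-subspace of GF(2)^40), every nonzero element of C_E^40 has Hamming weight at least 8, and some element has Hamming weight exactly 8. -/
open Matrix
open scoped Classical

noncomputable section

/-- φ : GF(4) → GF(2)⁴ with φ(0)=0000, φ(1)=0011, φ(ω)=0101, φ(ω̄)=0110. -/
def phi (ω : F4) (x : F4) : Fin 4 → F2 :=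
  if x = 0 then ![0, 0, 0, 0]
  else if x = 1 then ![0, 0, 1, 1]
  else if x = ω then ![0, 1, 0, 1]
  else ![0, 1, 1, 0]

/-- Φ applies φ to each coordinate and concatenates. -/
def Phi (ω : F4) (v : Fin 10 → F4) : Fin 40 → F2 := fun j =>
  phi ω (v ⟨j.val / 4, by have := j.isLt; omega⟩) ⟨j.val % 4, by omega⟩

/-- u i (for i = 0, …, 8, corresponding to u_(i+1)) has ones exactly in the eight
positions 4(i+1)-3, …, 4(i+1)+4 (1-indexed). -/
def u (i : Fin 9) : Fin 40 → F2 := fun j =>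
  if 4 * i.val ≤ j.val ∧ j.val < 4 * i.val + 8 then 1 else 0

/-- (1,0,0,0) repeated 10 times. -/
def d1 : Fin 40 → F2 := fun j => if j.val % 4 = 0 then 1 else 0

/-- (1,0,0,0) repeated 9 times followed by (0,1,1,1). -/
def d2 : Fin 40 → F2 := fun j =>
  if j.val < 36 then (if j.val % 4 = 0 then 1 else 0)
  else (if j.val % 4 = 0 then 0 else 1)

def gensE40 (ω : F4) : Fin 22 → Fin 40 → F2 :=
  ![Phi ω (r1 ω), Phi ω (r2 ω), Phi ω (r3 ω), Phi ω (r4 ω), Phi ω (r5 ω), Phi ω (r6 ω),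
    Phi ω (r7 ω), Phi ω (r8 ω), Phi ω (r9 ω), Phi ω (r10 ω), Phi ω (r11 ω), Phi ω (r12 ω),
    u 0, u 1, u 2, u 3, u 4, u 5, u 6, u 7, u 8, d1]

def CE40 (ω : F4) : Submodule F2 (Fin 40 → F2) :=
  Submodule.span F2 (Set.range (gensE40 ω))

/-- The rows `r1, …, r12`, with `p + q * ω` in `GF(4)` recorded as the pair `(p, q)`. -/
def quaternaryRows : Fin 12 → Fin 10 → F2 × F2 :=
  ![![(1, 0), 0, 0, 0, 0, 0, (0, 1), 0, (0, 1), (1, 1)],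
    ![(0, 1), 0, 0, 0, 0, 0, (1, 1), 0, (1, 1), (1, 0)],
    ![0, (1, 0), 0, 0, 0, 0, (1, 1), (1, 0), (1, 0), (1, 0)],
    ![0, (0, 1), 0, 0, 0, 0, (1, 0), (0, 1), (0, 1), (0, 1)],
    ![0, 0, (1, 0), 0, 0, 0, (1, 0), (0, 1), (1, 1), 0],
    ![0, 0, (0, 1), 0, 0, 0, (0, 1), (1, 1), (1, 0), 0],
    ![0, 0, 0, (1, 0), 0, 0, 0, (1, 0), (0, 1), (1, 1)],
    ![0, 0, 0, (0, 1), 0, 0, 0, (0, 1), (1, 1), (1, 0)],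
    ![0, 0, 0, 0, (1, 0), 0, (1, 1), (1, 1), 0, (1, 0)],
    ![0, 0, 0, 0, (0, 1), 0, (1, 0), (1, 0), 0, (0, 1)],
    ![0, 0, 0, 0, 0, (1, 0), (1, 0), (0, 1), (1, 0), (1, 0)],
    ![0, 0, 0, 0, 0, (0, 1), (0, 1), (1, 1), (0, 1), (0, 1)]]

/-- The incidence of `u i` with the `k`-th block of four coordinates. -/
def pairRows (i : Fin 9) (k : Fin 10) : F2 :=
  if i.castSucc = k ∨ i.succ = k then 1 else 0

/-- The word of `C_4^10`, in pairs of bits, with coefficients `h`. -/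
def quaternaryWord (h : Fin 12 → F2) (k : Fin 10) : F2 × F2 :=
  ∑ i, h i • quaternaryRows i k

/-- The even-weight word with coefficients `a` on the adjacent pairs. -/
def pairWord (a : Fin 9 → F2) (k : Fin 10) : F2 :=
  ∑ i, a i * pairRows i k

/-- A block of four coordinates of a word of `C_E^40`. -/
def block (e a : F2) (c : F2 × F2) : Fin 4 → F2 :=
  ![a + e, a + c.2, a + c.1, a + c.1 + c.2]

/-- The element `p + q * ω` of `GF(4)`. -/
def toF4 (ω : F4) (c : F2 × F2) : F4 :=
  algebraMap F2 F4 c.1 + algebraMap F2 F4 c.2 * ω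

theorem phi_toF4 {ω : F4} (hω : ω ^ 2 = ω + 1) (c : F2 × F2) :
    phi ω (toF4 ω c) = ![0, c.2, c.1, c.1 + c.2] := by
  have two : (1 : F4) + 1 = 0 := CharTwo.add_self_eq_zero 1
  have ne_zero : ω ≠ 0 := by rintro rfl; simp at hω
  have ne_one : ω ≠ 1 := by rintro rfl; simp [two] at hω
  have add_ne_zero : 1 + ω ≠ 0 := fun h => ne_one (by linear_combination h - two)
  have cases_bit : ∀ x : F2, x = 0 ∨ x = 1 := by decide
  obtain ⟨p, q⟩ := c
  rcases cases_bit p with rfl | rfl <;> rcases cases_bit q with rfl | rfl <;>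
    simp [toF4, phi, ne_zero, ne_one, add_ne_zero, CharTwo.add_self_eq_zero]

theorem gensE40_castAdd (ω : F4) (i : Fin 12) :
    gensE40 ω (Fin.castAdd 10 i) = Phi ω (fun k => toF4 ω (quaternaryRows i k)) := by
  fin_cases i <;> refine congrArg (Phi ω) (funext fun k => ?_) <;> fin_cases k <;>
    simp [toF4, quaternaryRows, r1, r2, r3, r4, r5, r6, r7, r8, r9, r10, r11, r12, add_comm]

theorem gensE40_natAdd_castSucc (ω : F4) (i : Fin 9) :
    gensE40 ω (Fin.natAdd 12 i.castSucc) = u i := by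
  fin_cases i <;> rfl

theorem Phi_toF4_apply {ω : F4} (hω : ω ^ 2 = ω + 1) (c : Fin 10 → F2 × F2) (k : Fin 10)
    (t : Fin 4) : Phi ω (fun k => toF4 ω (c k)) (finProdFinEquiv (k, t)) = block 0 0 (c k) t := by
  have hk : (finProdFinEquiv (k, t)).val / 4 = k := by
    simp only [finProdFinEquiv_apply_val]; omega
  have ht : (finProdFinEquiv (k, t)).val % 4 = t := by
    simp only [finProdFinEquiv_apply_val]; omega
  simp only [Phi, hk, ht, phi_toF4 hω, block, zero_add, Fin.eta]

theorem u_apply (i : Fin 9) (k : Fin 10) (t : Fin 4) :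
    u i (finProdFinEquiv (k, t)) = pairRows i k := by
  simp only [u, pairRows, Fin.ext_iff, finProdFinEquiv_apply_val, Fin.val_castSucc, Fin.val_succ]
  congr 1
  exact propext (by omega)

theorem d1_apply (k : Fin 10) (t : Fin 4) :
    d1 (finProdFinEquiv (k, t)) = block 1 0 0 t := by
  simp only [d1, finProdFinEquiv_apply_val, Nat.add_mul_mod_self_left, Nat.mod_eq_of_lt t.isLt]
  fin_cases t <;> simp [block]

theorem sum_gensE40_apply {ω : F4} (hω : ω ^ 2 = ω + 1) (g : Fin 22 → F2) (k : Fin 10)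
    (t : Fin 4) :
    (∑ i, g i • gensE40 ω i) (finProdFinEquiv (k, t)) =
      block (g 21) (pairWord (fun i => g (Fin.natAdd 12 i.castSucc)) k)
        (quaternaryWord (fun i => g (Fin.castAdd 10 i)) k) t := by
  have last_eq : (Fin.natAdd 12 (Fin.last 9) : Fin 22) = 21 := rfl
  have d1_eq : gensE40 ω 21 = d1 := rfl
  rw [Fin.sum_univ_add (a := 12) (b := 10), Fin.sum_univ_castSucc (n := 9)]
  simp only [Pi.add_apply, Finset.sum_apply, Pi.smul_apply, gensE40_castAdd,
    gensE40_natAdd_castSucc, d1_eq, last_eq, Phi_toF4_apply hω, u_apply, d1_apply]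
  fin_cases t <;>
    simp [block, pairWord, quaternaryWord, Prod.fst_sum, Prod.snd_sum, mul_add,
      Finset.sum_add_distrib] <;> ring

theorem wt_eq_sum {n : ℕ} (v : Fin n → F2) : wt v = ∑ j, if v j ≠ 0 then 1 else 0 := by
  simp only [wt, Nat.card_eq_fintype_card, Fintype.card_subtype, Finset.card_filter]

theorem wt_eq_sum_blocks (v : Fin 40 → F2) :
    wt v = ∑ k : Fin 10, wt (fun t : Fin 4 => v (finProdFinEquiv (k, t))) := by
  simp only [wt_eq_sum]
  rw [← Equiv.sum_comp (finProdFinEquiv (m := 10) (n := 4)), Fintype.sum_prod_type]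

theorem one_le_wt_block_one (a : F2) (c : F2 × F2) : 1 ≤ wt (block 1 a c) := by
  rw [wt_eq_sum]
  revert a c
  decide

theorem wt_block_zero (a : F2) (c : F2 × F2) :
    wt (block 0 a c) = if c ≠ 0 then 2 else if a ≠ 0 then 4 else 0 := by
  rw [wt_eq_sum]
  revert a c
  decide

theorem quaternaryWord_eq (h : Fin 12 → F2) :
    quaternaryWord h = ![(h 0, h 1), (h 2, h 3), (h 4, h 5), (h 6, h 7), (h 8, h 9), (h 10, h 11),
      (h 1 + h 2 + h 3 + h 4 + h 8 + h 9 + h 10, h 0 + h 1 + h 2 + h 5 + h 8 + h 11),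
      (h 2 + h 5 + h 6 + h 8 + h 9 + h 11, h 3 + h 4 + h 5 + h 7 + h 8 + h 10 + h 11),
      (h 1 + h 2 + h 4 + h 5 + h 7 + h 10, h 0 + h 1 + h 3 + h 4 + h 6 + h 7 + h 11),
      (h 0 + h 1 + h 2 + h 6 + h 7 + h 8 + h 10, h 0 + h 3 + h 6 + h 9 + h 11)] := by
  ext k <;> fin_cases k <;> simp [quaternaryWord, quaternaryRows, Fin.sum_univ_succ, add_assoc]

/-- The weight of one quaternary symbol, given by its two bits. -/
def pairWeight (p q : Bool) : ℕ := bif p || q then 1 else 0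

theorem four_le_sum_pairWeight : ∀ x0 x1 x2 x3 x4 x5 x6 x7 x8 x9 x10 x11 : Bool,
    0 < pairWeight x0 x1 + pairWeight x2 x3 + pairWeight x4 x5 +
        pairWeight x6 x7 + pairWeight x8 x9 + pairWeight x10 x11 →
    4 ≤ pairWeight x0 x1 + pairWeight x2 x3 + pairWeight x4 x5 +
        pairWeight x6 x7 + pairWeight x8 x9 + pairWeight x10 x11 +
        pairWeight (x1 ^^ x2 ^^ x3 ^^ x4 ^^ x8 ^^ x9 ^^ x10) (x0 ^^ x1 ^^ x2 ^^ x5 ^^ x8 ^^ x11) +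
        pairWeight (x2 ^^ x5 ^^ x6 ^^ x8 ^^ x9 ^^ x11) (x3 ^^ x4 ^^ x5 ^^ x7 ^^ x8 ^^ x10 ^^ x11) +
        pairWeight (x1 ^^ x2 ^^ x4 ^^ x5 ^^ x7 ^^ x10) (x0 ^^ x1 ^^ x3 ^^ x4 ^^ x6 ^^ x7 ^^ x11) +
        pairWeight (x0 ^^ x1 ^^ x2 ^^ x6 ^^ x7 ^^ x8 ^^ x10) (x0 ^^ x3 ^^ x6 ^^ x9 ^^ x11) := by
  decide +kernel

theorem bne_zero_add : ∀ x y : F2, (x + y != 0) = ((x != 0) ^^ (y != 0)) := by decide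

theorem ite_pair_ne_zero : ∀ p q : F2,
    (if (p, q) ≠ 0 then 1 else 0) = pairWeight (p != 0) (q != 0) := by decide

theorem pairWeight_eq_zero : ∀ p q : F2, pairWeight (p != 0) (q != 0) = 0 → p = 0 ∧ q = 0 := by
  decide

theorem four_le_sum_quaternaryWord (h : Fin 12 → F2) (h_ne : h ≠ 0) :
    4 ≤ ∑ k, if quaternaryWord h k ≠ 0 then 1 else 0 := by
  have key := four_le_sum_pairWeight (h 0 != 0) (h 1 != 0) (h 2 != 0) (h 3 != 0)
    (h 4 != 0) (h 5 != 0) (h 6 != 0) (h 7 != 0) (h 8 != 0) (h 9 != 0) (h 10 != 0)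
    (h 11 != 0)
  simp only [← bne_zero_add] at key
  simp only [Fin.sum_univ_castSucc, Fin.sum_univ_zero, zero_add, quaternaryWord_eq]
  simp only [← ite_pair_ne_zero] at key
  refine key ?_
  by_contra! sum_zero
  simp only [ite_pair_ne_zero] at sum_zero
  refine h_ne (funext fun i => ?_)
  have h₀ := pairWeight_eq_zero (h 0) (h 1) (by omega)
  have h₂ := pairWeight_eq_zero (h 2) (h 3) (by omega)
  have h₄ := pairWeight_eq_zero (h 4) (h 5) (by omega)
  have h₆ := pairWeight_eq_zero (h 6) (h 7) (by omega)
  have h₈ := pairWeight_eq_zero (h 8) (h 9) (by omega)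
  have hlast := pairWeight_eq_zero (h 10) (h 11) (by omega)
  fin_cases i <;> simp [*]

theorem pairWord_eq (a : Fin 9 → F2) :
    pairWord a = ![a 0, a 0 + a 1, a 1 + a 2, a 2 + a 3, a 3 + a 4, a 4 + a 5, a 5 + a 6,
      a 6 + a 7, a 7 + a 8, a 8] := by
  ext k
  fin_cases k <;> simp [pairWord, pairRows, Fin.sum_univ_succ]

theorem two_le_sum_pairWord (a : Fin 9 → F2) (a_ne : a ≠ 0) :
    2 ≤ ∑ k, if pairWord a k ≠ 0 then 1 else 0 := by
  rw [pairWord_eq]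
  revert a
  decide +kernel

theorem eight_le_wt_sum {ω : F4} (hω : ω ^ 2 = ω + 1) {g : Fin 22 → F2} (hg : g ≠ 0) :
    8 ≤ wt (∑ i, g i • gensE40 ω i) := by
  rw [wt_eq_sum_blocks]
  simp only [sum_gensE40_apply hω]
  set a := fun i : Fin 9 => g (Fin.natAdd 12 i.castSucc)
  set h := fun i : Fin 12 => g (Fin.castAdd 10 i)
  have cases_bit : ∀ x : F2, x = 0 ∨ x = 1 := by decide
  rcases cases_bit (g 21) with he | he <;> rw [he]
  · by_cases h_zero : h = 0
    · have a_ne : a ≠ 0 := by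
        refine fun a_zero => hg (funext fun i => ?_)
        refine Fin.addCases (m := 12) (n := 10) (congrFun h_zero) (fun j => ?_) i
        exact Fin.lastCases (n := 9) he (congrFun a_zero) j
      have word_zero (k : Fin 10) : quaternaryWord h k = 0 := by simp [quaternaryWord, h_zero]
      calc 8 ≤ 4 * ∑ k, if pairWord a k ≠ 0 then 1 else 0 := by
            have := two_le_sum_pairWord a a_ne; omega
        _ ≤ _ := by
            rw [Finset.mul_sum]
            refine Finset.sum_le_sum fun k _ => ?_
            change _ ≤ wt (block _ _ _)
            rw [wt_block_zero]
            simp [word_zero]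
    · calc 8 ≤ 2 * ∑ k, if quaternaryWord h k ≠ 0 then 1 else 0 := by
            have := four_le_sum_quaternaryWord h h_zero; omega
        _ ≤ _ := by
            rw [Finset.mul_sum]
            refine Finset.sum_le_sum fun k _ => ?_
            change _ ≤ wt (block _ _ _)
            rw [wt_block_zero]
            split_ifs <;> simp
  · calc 8 ≤ ∑ _k : Fin 10, 1 := by simp
      _ ≤ _ := Finset.sum_le_sum fun k _ => one_le_wt_block_one _ _

theorem linearIndependent_gensE40 {ω : F4} (hω : ω ^ 2 = ω + 1) :
    LinearIndependent F2 (gensE40 ω) := by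
  refine Fintype.linearIndependent_iff.2 fun g hg => congrFun ?_
  by_contra g_ne
  have := eight_le_wt_sum hω g_ne
  simp [hg, wt_eq_sum] at this

theorem wt_u_zero : wt (u 0) = 8 := by
  rw [wt_eq_sum]
  decide

theorem stmt12 (ω : F4) (hω : ω ^ 2 = ω + 1) :
    LinearIndependent F2 (gensE40 ω) ∧
    Module.finrank F2 (CE40 ω) = 22 ∧
    (∀ v ∈ CE40 ω, v ≠ 0 → 8 ≤ wt v) ∧ (∃ v ∈ CE40 ω, wt v = 8) := by
  refine ⟨linearIndependent_gensE40 hω, ?_, fun v hv v_ne => ?_, u 0, ?_, wt_u_zero⟩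
  · rw [CE40, finrank_span_eq_card (linearIndependent_gensE40 hω), Fintype.card_fin]
  · obtain ⟨g, rfl⟩ := (Submodule.mem_span_range_iff_exists_fun F2).1 hv
    exact eight_le_wt_sum hω fun hg => v_ne (by simp [hg])
  · exact Submodule.subset_span ⟨12, rfl⟩
end
end
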